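/- If σ + ε = 1 and 1 < σ ≤ (104√2 − 12)/79, then the CCG stiffness matrix T_{ε,σ} is monotone: it is invertible and every entry of its inverse is nonnegative (even though its off-diagonal entry c = (σ−1)/4 is positive, so T_{ε,σ} is not an M-matrix). -/

import Mathlib

open Matrix Finset

/-- The CCG stiffness matrix `T_{ε,σ}` of size `N × N` (1-based indices `1,…,N`, mesh size `h = 1`). -/
noncomputable def ccgT (ε σ : ℝ) (N : ℕ) : Matrix (Fin N) (Fin N) ℝ :=
  fun i j =>
    let I := i.val + 1
    let J := j.val + 1
    let a : ℝ := 5*σ/4 - ε/4 + 3/4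
    let b : ℝ := ε/16 - 15*σ/16 - 1/16
    let c : ℝ := ε/8 + 3*σ/8 - 3/8
    let d : ℝ := 1/16 - σ/16 - ε/16
    let a₁ : ℝ := 5*σ/4 - 3*ε/16 + 11/16
    let a₀ : ℝ := 13*σ/8 - 5*ε/16 + 13/16
    let b₀ : ℝ := 5/16 - 9*σ/8 - ε/16
    let c₀ : ℝ := 3*ε/16 + 7*σ/16 - 7/16
    if I = J then
      (if I = 1 ∨ I = N then a₀ else if I = 2 ∨ I = N - 1 then a₁ else a)
    else if J = I + 1 ∨ I = J + 1 then
      (if (I = 1 ∧ J = 2) ∨ (I = 2 ∧ J = 1) ∨ (I = N - 1 ∧ J = N) ∨ (I = N ∧ J = N - 1)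
        then b₀ else b)
    else if J = I + 2 ∨ I = J + 2 then
      (if (I = 1 ∧ J = 3) ∨ (I = 3 ∧ J = 1) ∨ (I = N - 2 ∧ J = N) ∨ (I = N ∧ J = N - 2)
        then c₀ else c)
    else if J = I + 3 ∨ I = J + 3 then d
    else 0

/-- A concave sequence whose end slopes satisfy Robin-type conditions is nonnegative. -/
lemma nonneg_of_concave_of_robin {m : ℕ} {y : ℕ → ℝ} (h0 : y 1 ≤ 3 * y 0)
    (hi : ∀ i < m, y i + y (i + 2) ≤ 2 * y (i + 1)) (hm : y m ≤ 3 * y (m + 1)) :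
    ∀ i ≤ m + 1, 0 ≤ y i := by
  have hex : ∃ i, i ≤ m + 1 ∧ ∀ j ≤ m + 1, y i ≤ y j := by
    obtain ⟨i, hi, h⟩ := (Finset.range (m + 2)).exists_min_image y ⟨0, by simp⟩
    exact ⟨i, by simp at hi; omega, fun j hj => h j (by simp; omega)⟩
  classical
  obtain ⟨hk, hmin⟩ := Nat.find_spec hex
  have hlt := fun j => Nat.find_min hex (m := j)
  generalize Nat.find hex = k at hk hmin hlt
  suffices h : 0 ≤ y k from fun i h_i => h.trans (hmin i h_i)
  by_contra! hneg
  rcases k with _ | k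
  · linarith [hmin 1 (by omega)]
  · rcases eq_or_lt_of_le hk with h | h
    · obtain rfl : k = m := by omega
      linarith [hmin k (by omega)]
    · refine hlt k (by omega) ⟨by omega, fun j hj => ?_⟩
      linarith [hi k (by omega), hmin (k + 2) (by omega), hmin j hj]

lemma le_linear_of_concave {m : ℕ} {y : ℕ → ℝ} (h0 : y 1 ≤ 3 * y 0)
    (hi : ∀ i < m, y i + y (i + 2) ≤ 2 * y (i + 1)) :
    ∀ i ≤ m + 1, y i ≤ (2 * i + 1) * y 0 := by
  have key : ∀ i ≤ m, y (i + 1) - y i ≤ 2 * y 0 := by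
    intro i
    induction i with
    | zero => intro _; simp only [zero_add]; linarith
    | succ i ih => intro h; linarith [ih (by omega), hi i (by omega)]
  intro i
  induction i with
  | zero => intro _; simp
  | succ i ih => intro h; push_cast; linarith [ih (by omega), key i (by omega)]

/-- Minimum principle for `I + c K`, where `K` is the second-difference operator. -/
lemma nonneg_of_resolvent {m : ℕ} {c : ℝ} {x : ℕ → ℝ} (hc : 0 < c)
    (h0 : (∀ j ≤ m + 1, x 0 ≤ x j) → 0 ≤ x 0)
    (hi : ∀ i < m, 0 ≤ (1 + 2 * c) * x (i + 1) - c * (x i + x (i + 2)))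
    (hm : (∀ j ≤ m + 1, x (m + 1) ≤ x j) → 0 ≤ x (m + 1)) :
    ∀ i ≤ m + 1, 0 ≤ x i := by
  obtain ⟨k, hk, hmin⟩ := (Finset.range (m + 2)).exists_min_image x ⟨0, by simp⟩
  replace hmin : ∀ j ≤ m + 1, x k ≤ x j := fun j hj => hmin j (by simp; omega)
  simp only [Finset.mem_range] at hk
  suffices h : 0 ≤ x k from fun i h_i => h.trans (hmin i h_i)
  rcases k with _ | k
  · exact h0 hmin
  · by_cases h : k = m
    · subst h; exact hm hmin
    · have h1 := mul_nonneg hc.le (sub_nonneg.2 (hmin k (by omega)))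
      have h2 := mul_nonneg hc.le (sub_nonneg.2 (hmin (k + 2) (by omega)))
      linarith [hi k (by omega)]

/-- For small `c` the end value is nonnegative: otherwise the sequence would grow too fast to
meet the condition at the other end. -/
lemma end_nonneg_of_small {m : ℕ} {c : ℝ} {x y : ℕ → ℝ} (hm : 0 < m) (hc : 0 < c)
    (hc' : c < 1 / 12) (hy : 0 ≤ y 0) (hlin : ∀ i ≤ m + 1, y i ≤ (2 * i + 1) * y 0)
    (h0 : (13 + 36 * c) / 16 * x 0 + (1 - 12 * c) / 16 * x 1 = y 0)
    (hi : ∀ i < m, (1 + 2 * c) * x (i + 1) - c * (x i + x (i + 2)) = y (i + 1))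
    (hend : (13 + 36 * c) / 16 * x (m + 1) + (1 - 12 * c) / 16 * x m = y (m + 1)) :
    0 ≤ x 0 := by
  by_contra! hneg
  have hx1 : 16 * y 0 < x 1 := by
    have h1 : y 0 < (1 - 12 * c) / 16 * x 1 := by nlinarith
    have h2 : 0 < x 1 := pos_of_mul_pos_right (hy.trans_lt h1) (by linarith)
    nlinarith
  have key : ∀ i ≤ m, (15 * (i + 1) + 1) * y 0 < x (i + 1) ∧ 15 * y 0 < x (i + 1) - x i := by
    intro i
    induction i with
    | zero => intro _; constructor <;> norm_num <;> linarith
    | succ i ih =>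
      intro h
      obtain ⟨ha, hb⟩ := ih (by omega)
      have hl := hlin (i + 1) (by omega)
      have he := hi i (by omega)
      push_cast at hl ⊢
      have hiy : 0 ≤ i * y 0 := by positivity
      have hd : 15 * y 0 < x (i + 2) - x (i + 1) := by
        have h1 : 0 < c * (x (i + 1) - x i - 15 * y 0) := mul_pos hc (by linarith)
        have h2 : 0 < c * (x (i + 2) - x (i + 1) - 15 * y 0) := by linarith
        linarith [pos_of_mul_pos_right h2 hc.le]
      exact ⟨by rw [show i + 1 + 1 = i + 2 from rfl]; linarith, hd⟩
  obtain ⟨k, rfl⟩ : ∃ k, m = k + 1 := ⟨m - 1, by omega⟩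
  have h1 := (key (k + 1) le_rfl).1
  have h2 := (key k (by omega)).1
  have h3 := hlin (k + 1 + 1) le_rfl
  push_cast at h1 h3
  have hky : 0 ≤ k * y 0 := by positivity
  have h4 : 0 ≤ (1 - 12 * c) / 16 * x (k + 1) := mul_nonneg (by linarith) (by linarith)
  have h5 : 0 < c * x (k + 1 + 1) := mul_pos hc (by linarith)
  linarith

/-- Monotonicity of the product of the two tridiagonal factors of the stiffness matrix. -/
lemma nonneg_of_factorization {m : ℕ} {c : ℝ} {x y : ℕ → ℝ} (hm : 0 < m) (hc : 0 < c)
    (hy0 : y 1 ≤ 3 * y 0) (hyi : ∀ i < m, y i + y (i + 2) ≤ 2 * y (i + 1))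
    (hym : y m ≤ 3 * y (m + 1))
    (h0 : (13 + 36 * c) / 16 * x 0 + (1 - 12 * c) / 16 * x 1 = y 0)
    (hi : ∀ i < m, (1 + 2 * c) * x (i + 1) - c * (x i + x (i + 2)) = y (i + 1))
    (hend : (13 + 36 * c) / 16 * x (m + 1) + (1 - 12 * c) / 16 * x m = y (m + 1)) :
    ∀ i ≤ m + 1, 0 ≤ x i := by
  have hy := nonneg_of_concave_of_robin hy0 hyi hym
  have hi' : ∀ i < m, 0 ≤ (1 + 2 * c) * x (i + 1) - c * (x i + x (i + 2)) := fun i h =>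
    (hi i h).symm ▸ hy (i + 1) (by omega)
  rcases lt_or_ge c (1 / 12) with hc' | hc'
  · have hrev : ∀ i < m, m + 1 - i = m - 1 - i + 2 ∧ m + 1 - (i + 1) = m - 1 - i + 1 ∧
        m + 1 - (i + 2) = m - 1 - i := by omega
    refine nonneg_of_resolvent hc (fun _ => ?_) hi' (fun _ => ?_)
    · exact end_nonneg_of_small hm hc hc' (hy 0 (by omega)) (le_linear_of_concave hy0 hyi)
        h0 hi hend
    · refine end_nonneg_of_small (x := fun i => x (m + 1 - i)) (y := fun i => y (m + 1 - i))
        hm hc hc' (hy _ (by omega)) (le_linear_of_concave (by simpa using hym) ?_)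
        (by simpa using hend) ?_ (by simpa using h0)
      · intro i h
        obtain ⟨e0, e1, e2⟩ := hrev i h
        simp only [e0, e1, e2]
        linarith [hyi (m - 1 - i) (by omega)]
      · intro i h
        obtain ⟨e0, e1, e2⟩ := hrev i h
        simp only [e0, e1, e2]
        linarith [hi (m - 1 - i) (by omega)]
  · have hneg : ∀ u v : ℝ, u ≤ v →
        0 ≤ (13 + 36 * c) / 16 * u + (1 - 12 * c) / 16 * v → 0 ≤ u := by
      intro u v huv h
      by_contra! hu
      nlinarith
    refine nonneg_of_resolvent hc (fun h => ?_) hi' (fun h => ?_)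
    · exact hneg _ _ (h 1 (by omega)) (h0 ▸ hy 0 (by omega))
    · exact hneg _ _ (h m (by omega)) (hend ▸ hy (m + 1) le_rfl)

lemma sum_range_eq_sum_window {N k L : ℕ} (f : ℕ → ℝ) (hkL : k + L ≤ N)
    (hf : ∀ j < N, j < k ∨ k + L ≤ j → f j = 0) :
    ∑ j ∈ Finset.range N, f j = ∑ i ∈ Finset.range L, f (k + i) := by
  rw [Finset.range_eq_Ico, ← Finset.sum_Ico_consecutive f (Nat.zero_le k) (by omega : k ≤ N),
    ← Finset.sum_Ico_consecutive f (Nat.le_add_right k L) hkL,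
    Finset.sum_eq_zero (s := Finset.Ico 0 k) (f := f),
    Finset.sum_eq_zero (s := Finset.Ico (k + L) N) (f := f),
    Finset.sum_Ico_eq_sum_range]
  · simp
  · intro j hj; simp at hj; exact hf j (by omega) (by omega)
  · intro j hj; simp at hj; exact hf j (by omega) (by omega)

/-- Entries of `ccgT (-4 * c) (1 + 4 * c) N`, for zero-based natural number indices. -/
noncomputable def ccgEntry (c : ℝ) (N i j : ℕ) : ℝ :=
  if i = j then
    (if i = 0 ∨ i + 1 = N then 39 / 16 + 31 / 4 * c
      else if i = 1 ∨ i + 2 = N then 31 / 16 + 23 / 4 * c else 2 + 6 * c)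
  else if j = i + 1 ∨ i = j + 1 then
    (if i + j = 1 ∨ i + j + 3 = 2 * N then -(13 / 16) - 17 / 4 * c else -1 - 4 * c)
  else if j = i + 2 ∨ i = j + 2 then c
  else 0

lemma ccgT_apply_eq_ccgEntry {ε σ c : ℝ} {N : ℕ} (hN : 7 ≤ N) (hε : ε = -4 * c)
    (hσ : σ = 1 + 4 * c) (i j : Fin N) : ccgT ε σ N i j = ccgEntry c N i j := by
  subst hε hσ
  have hi := i.isLt
  have hj := j.isLt
  simp only [ccgT, ccgEntry]
  split_ifs <;> first | omega | ring

section ccgEntry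

variable {c : ℝ} {N i j : ℕ}

lemma ccgEntry_diag_end (hij : i = j) (h : i = 0 ∨ i + 1 = N) :
    ccgEntry c N i j = 39 / 16 + 31 / 4 * c := by
  rw [ccgEntry, if_pos hij, if_pos h]

lemma ccgEntry_diag_near_end (hij : i = j) (h : i = 1 ∨ i + 2 = N) (hN : 7 ≤ N) :
    ccgEntry c N i j = 31 / 16 + 23 / 4 * c := by
  rw [ccgEntry, if_pos hij, if_neg (by omega), if_pos h]

lemma ccgEntry_diag_interior (hij : i = j) (h : 2 ≤ i) (h' : i + 3 ≤ N) :
    ccgEntry c N i j = 2 + 6 * c := by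
  rw [ccgEntry, if_pos hij, if_neg (by omega), if_neg (by omega)]

lemma ccgEntry_adj_end (hij : j = i + 1 ∨ i = j + 1) (h : i + j = 1 ∨ i + j + 3 = 2 * N) :
    ccgEntry c N i j = -(13 / 16) - 17 / 4 * c := by
  rw [ccgEntry, if_neg (by omega), if_pos hij, if_pos h]

lemma ccgEntry_adj_interior (hij : j = i + 1 ∨ i = j + 1) (h : 2 ≤ i + j)
    (h' : i + j + 4 ≤ 2 * N) : ccgEntry c N i j = -1 - 4 * c := by
  rw [ccgEntry, if_neg (by omega), if_pos hij, if_neg (by omega)]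

lemma ccgEntry_of_dist_two (hij : j = i + 2 ∨ i = j + 2) : ccgEntry c N i j = c := by
  rw [ccgEntry, if_neg (by omega), if_neg (by omega), if_pos hij]

end ccgEntry

lemma nonneg_of_ccgT_mulVec_nonneg {ε σ : ℝ} {N : ℕ} (hN : 7 ≤ N) (hεσ : σ + ε = 1)
    (hσ : 1 < σ) (x : Fin N → ℝ) (hx : ∀ i, 0 ≤ (ccgT ε σ N *ᵥ x) i) : ∀ i, 0 ≤ x i := by
  obtain ⟨c, hc⟩ : ∃ c : ℝ, c = (σ - 1) / 4 := ⟨_, rfl⟩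
  have hcpos : 0 < c := by linarith
  obtain ⟨m, rfl⟩ : ∃ m, N = m + 2 := ⟨N - 2, by omega⟩
  set X : ℕ → ℝ := fun i => if h : i < m + 2 then x ⟨i, h⟩ else 0 with hX
  have hXx : ∀ i : Fin (m + 2), X i = x i := fun i => by simp [hX]
  have hrow : ∀ i < m + 2, 0 ≤ ∑ j ∈ Finset.range (m + 2), ccgEntry c (m + 2) i j * X j := by
    intro i h
    refine (hx ⟨i, h⟩).trans_eq ?_
    rw [Matrix.mulVec, dotProduct,
      ← Fin.sum_univ_eq_sum_range (fun j => ccgEntry c (m + 2) i j * X j)]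
    refine Finset.sum_congr rfl fun j _ => ?_
    rw [ccgT_apply_eq_ccgEntry hN (by linarith) (by linarith : σ = 1 + 4 * c), hXx]
  have hwin : ∀ i < m + 2, ∀ k L, k + L ≤ m + 2 → k ≤ i → (k = 0 ∨ k + 2 ≤ i) →
      (k + L = m + 2 ∨ i + 3 ≤ k + L) →
      0 ≤ ∑ j ∈ Finset.range L, ccgEntry c (m + 2) i (k + j) * X (k + j) := by
    intro i hi k L h1 h2 h3 h4
    refine (hrow i hi).trans_eq (sum_range_eq_sum_window _ h1 fun j hj hj' => ?_)
    simp only [ccgEntry]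
    rw [if_neg (by omega), if_neg (by omega), if_neg (by omega), zero_mul]
  obtain ⟨y, hyX⟩ : ∃ y : ℕ → ℝ, y = fun i =>
      if i = 0 then (13 + 36 * c) / 16 * X 0 + (1 - 12 * c) / 16 * X 1
      else if i = m + 1 then (13 + 36 * c) / 16 * X (m + 1) + (1 - 12 * c) / 16 * X m
      else (1 + 2 * c) * X i - c * (X (i - 1) + X (i + 1)) := ⟨_, rfl⟩
  have hy0 : y 0 = (13 + 36 * c) / 16 * X 0 + (1 - 12 * c) / 16 * X 1 := by simp [hyX]
  have hyi : ∀ i < m, y (i + 1) = (1 + 2 * c) * X (i + 1) - c * (X i + X (i + 2)) := by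
    intro i h
    simp [hyX, h.ne]
  have hym : y (m + 1) = (13 + 36 * c) / 16 * X (m + 1) + (1 - 12 * c) / 16 * X m := by
    simp [hyX]
  obtain ⟨p, rfl⟩ : ∃ p, m = p + 3 := ⟨m - 3, by omega⟩
  have hres := nonneg_of_factorization (m := p + 3) (c := c) (x := X) (y := y) (by omega) hcpos
    ?_ ?_ ?_ hy0.symm (fun i h => (hyi i h).symm) hym.symm
  · intro i
    rw [← hXx i]
    exact hres i (by have := i.isLt; omega)
  · have h := hwin 0 (by omega) 0 3 (by omega) (by omega) (by omega) (by omega)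
    simp only [Finset.sum_range_succ, Finset.sum_range_zero, zero_add] at h
    rw [ccgEntry_diag_end (by omega) (by omega),
      ccgEntry_adj_end (by omega) (by omega),
      ccgEntry_of_dist_two (by omega)] at h
    rw [hy0, hyi 0 (by omega)]
    simp only [zero_add, add_assoc] at h ⊢
    linarith
  · intro i hi
    rcases i with _ | i
    · have h := hwin 1 (by omega) 0 4 (by omega) (by omega) (by omega) (by omega)
      simp only [Finset.sum_range_succ, Finset.sum_range_zero, zero_add] at h
      rw [ccgEntry_adj_end (by omega) (by omega),
        ccgEntry_diag_near_end (by omega) (by omega) hN,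
        ccgEntry_adj_interior (by omega) (by omega) (by omega),
        ccgEntry_of_dist_two (by omega)] at h
      rw [hy0, hyi 0 (by omega), hyi 1 (by omega)]
      simp only [zero_add, add_assoc, Nat.reduceAdd] at h ⊢
      linarith
    · by_cases hip : i = p + 1
      · subst hip
        have h := hwin (p + 3) (by omega) (p + 1) 4 (by omega) (by omega) (by omega) (by omega)
        simp only [Finset.sum_range_succ, Finset.sum_range_zero, zero_add, add_zero] at h
        rw [ccgEntry_of_dist_two (by omega),
          ccgEntry_adj_interior (by omega) (by omega) (by omega),
          ccgEntry_diag_near_end (by omega) (by omega) hN,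
          ccgEntry_adj_end (by omega) (by omega)] at h
        rw [hyi (p + 1) (by omega), hyi (p + 1 + 1) (by omega), hym]
        simp only [add_assoc, Nat.reduceAdd] at h ⊢
        linarith
      · have h := hwin (i + 2) (by omega) i 5 (by omega) (by omega) (by omega) (by omega)
        simp only [Finset.sum_range_succ, Finset.sum_range_zero, zero_add, add_zero] at h
        rw [ccgEntry_of_dist_two (by omega),
          ccgEntry_adj_interior (by omega) (by omega) (by omega),
          ccgEntry_diag_interior (by omega) (by omega) (by omega),
          ccgEntry_adj_interior (by omega) (by omega) (by omega),
          ccgEntry_of_dist_two (by omega)] at h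
        rw [hyi i (by omega), hyi (i + 1) (by omega), hyi (i + 1 + 1) (by omega)]
        simp only [add_assoc, Nat.reduceAdd] at h ⊢
        linarith
  · have h := hwin (p + 4) (by omega) (p + 2) 3 (by omega) (by omega) (by omega) (by omega)
    simp only [Finset.sum_range_succ, Finset.sum_range_zero, zero_add, add_zero] at h
    rw [ccgEntry_of_dist_two (by omega),
      ccgEntry_adj_end (by omega) (by omega),
      ccgEntry_diag_end (by omega) (by omega)] at h
    rw [hyi (p + 2) (by omega), hym]
    simp only [add_assoc, Nat.reduceAdd] at h ⊢
    linarith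

/-- If σ + ε = 1 and 1 < σ ≤ (104√2 − 12)/79, then the CCG stiffness
matrix `T_{ε,σ}` is monotone: it is invertible and every entry of its inverse is
nonnegative (even though its off-diagonal entry c = (σ−1)/4 = ε/8 + 3σ/8 − 3/8 is
positive, so `T_{ε,σ}` is not an M-matrix). -/
theorem ccgT_monotone (ε σ : ℝ) (N : ℕ) (hN : 7 ≤ N)
    (hεσ : σ + ε = 1) (hσ₁ : 1 < σ) (hσ₂ : σ ≤ (104 * Real.sqrt 2 - 12) / 79) :
    (IsUnit (ccgT ε σ N).det ∧ ∀ i j : Fin N, 0 ≤ (ccgT ε σ N)⁻¹ i j) ∧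
    0 < ε/8 + 3*σ/8 - 3/8 := by
  have hmono := fun x => nonneg_of_ccgT_mulVec_nonneg hN hεσ hσ₁ x
  have hdet : IsUnit (ccgT ε σ N).det := by
    rw [← Matrix.isUnit_iff_isUnit_det, ← Matrix.mulVec_injective_iff_isUnit]
    intro u v huv
    have h : ccgT ε σ N *ᵥ (u - v) = 0 := by rw [Matrix.mulVec_sub, huv, sub_self]
    have h' : ccgT ε σ N *ᵥ (v - u) = 0 := by rw [Matrix.mulVec_sub, huv, sub_self]
    funext i
    have h1 := hmono (u - v) (by simp [h]) i
    have h2 := hmono (v - u) (by simp [h']) i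
    simp only [Pi.sub_apply] at h1 h2
    linarith
  refine ⟨⟨hdet, fun i j => ?_⟩, by linarith⟩
  refine hmono (fun k => (ccgT ε σ N)⁻¹ k j) (fun k => ?_) i
  change 0 ≤ (ccgT ε σ N * (ccgT ε σ N)⁻¹) k j
  rw [Matrix.mul_nonsing_inv _ hdet, Matrix.one_apply]
  split_ifs <;> norm_num
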